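/- Let δ ∈ (0,1), let p : ℕ → ℝ be a sequence with δ ≤ p(t) ≤ 1 for all t ∈ ℕ, and let L > 0, η ≥ 0, σ ≥ 0, ζ ≥ 0 be reals. Let f : ℕ → ℝ and Ξ : ℕ → ℝ be sequences with f(t) ≥ 0 and Ξ(t) ≥ 0 for all t, and suppose that for every t ≥ 1, Ξ(t) ≤ (1 − p(t−1)/2)·Ξ(t−1) + η²·( 72·L·f(t−1)/p(t−1) + 8σ² + 18ζ²/p(t−1) ). Then for every integer T ≥ 1, ∑_{t=1}^T Ξ(t) ≤ π₀·Ξ(0) + 72η²L·∑_{j=0}^{T−1} f(j)·π_j/p(j) + 18η²·∑_{j=0}^{T−1} (σ² + ζ²/p(j))·π_j. -/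

import Mathlib

/-- `piSeq p j = ∑_{i > j} ∏_{t=j+1}^{i-1} (1 - p t / 2)`. -/
noncomputable def piSeq (p : ℕ → ℝ) (j : ℕ) : ℝ :=
  ∑' k : ℕ, ∏ t ∈ Finset.Ico (j + 1) (j + 1 + k), (1 - p t / 2)

theorem summable_prod_Ico_one_sub_half {p : ℕ → ℝ} {δ : ℝ} (hδ : 0 < δ)
    (hp : ∀ t, δ ≤ p t ∧ p t ≤ 1) (j : ℕ) :
    Summable fun k : ℕ => ∏ t ∈ Finset.Ico j (j + k), (1 - p t / 2) := by
  have hδ1 : δ ≤ 1 := (hp 0).1.trans (hp 0).2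
  have hnonneg (t : ℕ) : 0 ≤ 1 - p t / 2 := by linarith [(hp t).2]
  refine Summable.of_nonneg_of_le (fun k => Finset.prod_nonneg fun t _ => hnonneg t) (fun k => ?_)
    (summable_geometric_of_lt_one (r := 1 - δ / 2) (by linarith) (by linarith))
  calc ∏ t ∈ Finset.Ico j (j + k), (1 - p t / 2)
      ≤ ∏ _t ∈ Finset.Ico j (j + k), (1 - δ / 2) :=
        Finset.prod_le_prod (fun t _ => hnonneg t) fun t _ => by linarith [(hp t).1]
    _ = (1 - δ / 2) ^ k := by simp

theorem piSeq_nonneg {p : ℕ → ℝ} (hp : ∀ t, p t ≤ 1) (j : ℕ) : 0 ≤ piSeq p j :=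
  tsum_nonneg fun _ => Finset.prod_nonneg fun t _ => by linarith [hp t]

theorem piSeq_eq_one_add {p : ℕ → ℝ} {δ : ℝ} (hδ : 0 < δ)
    (hp : ∀ t, δ ≤ p t ∧ p t ≤ 1) (j : ℕ) :
    piSeq p j = 1 + (1 - p (j + 1) / 2) * piSeq p (j + 1) := by
  rw [piSeq, (summable_prod_Ico_one_sub_half hδ hp (j + 1)).tsum_eq_zero_add, piSeq,
    ← tsum_mul_left]
  congr 1
  · simp
  · refine tsum_congr fun k => ?_
    rw [Finset.prod_eq_prod_Ico_succ_bot (by lia)]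
    congr 3
    lia

/-- Unrolling `Ξ (t + 1) ≤ (1 - p t / 2) * Ξ t + e t` with the weights `piSeq p`. -/
theorem sum_le_of_contraction {p : ℕ → ℝ} {δ : ℝ} (hδ : 0 < δ)
    (hp : ∀ t, δ ≤ p t ∧ p t ≤ 1) {Ξ e : ℕ → ℝ} (hΞ : ∀ t, 0 ≤ Ξ t)
    (hrec : ∀ t, Ξ (t + 1) ≤ (1 - p t / 2) * Ξ t + e t) (T : ℕ) :
    ∑ t ∈ Finset.Icc 1 T, Ξ t ≤
      piSeq p 0 * Ξ 0 + ∑ j ∈ Finset.range T, e j * piSeq p j := by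
  have hpi := piSeq_nonneg fun t => (hp t).2
  have key : ∑ t ∈ Finset.Icc 1 T, Ξ t + (1 - p T / 2) * piSeq p T * Ξ T ≤
      (1 - p 0 / 2) * piSeq p 0 * Ξ 0 + ∑ j ∈ Finset.range T, e j * piSeq p j := by
    induction T with
    | zero => simp
    | succ T ih =>
      rw [Finset.sum_Icc_succ_top (by lia), Finset.sum_range_succ]
      have hstep := mul_le_mul_of_nonneg_left (hrec T) (hpi T)
      have hweight : Ξ (T + 1) + (1 - p (T + 1) / 2) * piSeq p (T + 1) * Ξ (T + 1) =
          piSeq p T * Ξ (T + 1) := by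
        rw [piSeq_eq_one_add hδ hp T]
        ring
      linarith
  have htail : 0 ≤ (1 - p T / 2) * piSeq p T * Ξ T :=
    mul_nonneg (mul_nonneg (by linarith [(hp T).2]) (hpi T)) (hΞ T)
  have hinit : 0 ≤ p 0 / 2 * (piSeq p 0 * Ξ 0) :=
    mul_nonneg (by linarith [(hp 0).1]) (mul_nonneg (hpi 0) (hΞ 0))
  linarith

theorem stmt10 (δ : ℝ) (hδ0 : 0 < δ) (hδ1 : δ < 1) (p : ℕ → ℝ)
    (hp : ∀ t : ℕ, δ ≤ p t ∧ p t ≤ 1)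
    (L η σ ζ : ℝ) (hL : 0 < L) (hη : 0 ≤ η) (hσ : 0 ≤ σ) (hζ : 0 ≤ ζ)
    (f Ξ : ℕ → ℝ) (hf : ∀ t, 0 ≤ f t) (hΞ : ∀ t, 0 ≤ Ξ t)
    (hrec : ∀ t : ℕ, 1 ≤ t →
      Ξ t ≤ (1 - p (t - 1) / 2) * Ξ (t - 1) +
        η ^ 2 * (72 * L * f (t - 1) / p (t - 1) + 8 * σ ^ 2 + 18 * ζ ^ 2 / p (t - 1))) :
    ∀ T : ℕ, 1 ≤ T →
      ∑ t ∈ Finset.Icc 1 T, Ξ t ≤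
        piSeq p 0 * Ξ 0 +
          72 * η ^ 2 * L * ∑ j ∈ Finset.range T, f j * piSeq p j / p j +
          18 * η ^ 2 * ∑ j ∈ Finset.range T, (σ ^ 2 + ζ ^ 2 / p j) * piSeq p j := by
  intro T _
  have hsum := sum_le_of_contraction hδ0 hp hΞ (fun t => hrec (t + 1) (by lia)) T
  simp only [Nat.add_sub_cancel] at hsum
  refine hsum.trans ?_
  rw [add_assoc, Finset.mul_sum, Finset.mul_sum, ← Finset.sum_add_distrib]
  gcongr with j _
  have hslack : 0 ≤ 10 * (η ^ 2 * σ ^ 2 * piSeq p j) :=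
    mul_nonneg (by norm_num) (mul_nonneg (by positivity) (piSeq_nonneg (fun t => (hp t).2) j))
  linear_combination hslack
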